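/- arXiv:1506.05593 — 2 statements merged into one kernel-verified Lean document; each statement's English description precedes it below -/
import Mathlib

section
/- For β ∈ ℂ with -1 < Re(β) < 0, the tempered distribution T(x) = |x|^β on ℝ has Fourier transform F T(y) = C_β / |y|^{β+1}, where C_β = 2^{β+1/2} Γ((β+1)/2) / Γ(-β/2), using the convention F g(y) = (2π)^{-1/2} ∫ e^{-ixy} g(x) dx. -/
open MeasureTheory Complex Real

/-- A nonpositive power of `|x|` that is locally integrable is integrable against any bounded
integrable function. -/
theorem integrable_abs_rpow_mul_norm {b : ℝ} (hb : -1 < b) (hb0 : b ≤ 0) {ψ : ℝ → ℂ} {M : ℝ}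
    (hψ : Integrable ψ) (hM : ∀ x, ‖ψ x‖ ≤ M) :
    Integrable fun x : ℝ ↦ |x| ^ b * ‖ψ x‖ := by
  have h1 : IntegrableOn (fun x : ℝ ↦ |x| ^ b) (Set.Ioc (-1) 1) := by
    have h := (intervalIntegral.intervalIntegrable_cpow' (a := -1) (b := 1) (r := (b : ℂ))
      (by simpa using hb)).norm
    rw [intervalIntegrable_iff_integrableOn_Ioc_of_le (by norm_num)] at h
    simpa [Complex.norm_cpow_real] using h
  have h2 := ((h1.integrable_indicator measurableSet_Ioc).const_mul M).add hψ.norm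
  refine h2.mono' ?_ (.of_forall fun x ↦ ?_)
  · exact (measurable_norm.pow_const b).aestronglyMeasurable.mul hψ.norm.aestronglyMeasurable
  · have hx : 0 ≤ |x| ^ b := by positivity
    rw [Real.norm_of_nonneg (by positivity)]
    simp only [Pi.add_apply, Set.indicator_apply]
    split_ifs with hm
    · nlinarith [hM x, norm_nonneg (ψ x)]
    · have : 1 ≤ |x| := by
        by_contra! h
        exact hm ⟨(abs_lt.1 h).1, (abs_lt.1 h).2.le⟩
      have : |x| ^ b ≤ 1 := Real.rpow_le_one_of_one_le_of_nonpos this hb0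
      nlinarith [norm_nonneg (ψ x)]

/-- The Mellin transform of the Gaussian averages of `ψ`, obtained by writing `|x| ^ (-2 * a)` as a
superposition of Gaussians. -/
theorem mellin_integral_gaussian_mul {a : ℂ} (ha0 : 0 < a.re) (ha1 : a.re < 1 / 2) {ψ : ℝ → ℂ}
    {M : ℝ} (hψ : Integrable ψ) (hM : ∀ x, ‖ψ x‖ ≤ M) :
    mellin (fun s ↦ ∫ x : ℝ, cexp (-((x ^ 2 / 2 : ℝ) * s)) * ψ x) a =
      2 ^ a * Complex.Gamma a * ∫ x : ℝ, ((|x| : ℝ) : ℂ) ^ (-2 * a) * ψ x := by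
  have hne : ∀ᵐ x : ℝ, x ≠ 0 := Measure.ae_ne volume 0
  have hint : Integrable (Function.uncurry fun (x s : ℝ) ↦
      (s : ℂ) ^ (a - 1) * cexp (-((x ^ 2 / 2 : ℝ) * s)) * ψ x)
      (volume.prod (volume.restrict (Set.Ioi 0))) := by
    refine (integrable_prod_iff ?_).2 ⟨?_, ?_⟩
    · refine AEStronglyMeasurable.mul ?_ hψ.aestronglyMeasurable.comp_fst
      refine Measurable.aestronglyMeasurable ?_
      fun_prop
    · filter_upwards [hne] with x hx
      refine Integrable.mul_const (f := fun s : ℝ ↦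
        (s : ℂ) ^ (a - 1) * cexp (-((x ^ 2 / 2 : ℝ) * s))) ?_ (ψ x)
      refine not_imp_comm.1 integral_undef ?_
      rw [Complex.integral_cpow_mul_exp_neg_mul_Ioi ha0 (by positivity)]
      refine mul_ne_zero ?_ (Complex.Gamma_ne_zero_of_re_pos ha0)
      rw [Complex.cpow_ne_zero_iff]
      left
      simpa using hx
    · have h := (integrable_abs_rpow_mul_norm (b := -2 * a.re) (by linarith) (by linarith)
        hψ hM).const_mul (2 ^ a.re * Real.Gamma a.re)
      refine h.congr ?_
      filter_upwards [hne] with x hx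
      have hx' : 0 < |x| := abs_pos.2 hx
      have e : ∫ s in Set.Ioi (0 : ℝ), ‖(s : ℂ) ^ (a - 1) * cexp (-((x ^ 2 / 2 : ℝ) * s)) * ψ x‖ =
          ∫ s in Set.Ioi (0 : ℝ), s ^ (a.re - 1) * Real.exp (-(x ^ 2 / 2 * s)) * ‖ψ x‖ := by
        refine setIntegral_congr_fun measurableSet_Ioi fun s hs ↦ ?_
        simp only [norm_mul, Complex.norm_cpow_eq_rpow_re_of_pos hs, Complex.norm_exp]
        norm_cast
      simp only [Function.uncurry_apply_pair]
      rw [e, integral_mul_const, Real.integral_rpow_mul_exp_neg_mul_Ioi ha0 (by positivity),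
        ← sq_abs, one_div_div, Real.div_rpow (by positivity) (by positivity),
        ← Real.rpow_natCast, ← Real.rpow_mul hx'.le, neg_mul, Real.rpow_neg hx'.le]
      push_cast
      ring
  simp only [mellin, smul_eq_mul, ← integral_const_mul, ← mul_assoc]
  rw [← integral_integral_swap hint]
  refine integral_congr_ae ?_
  filter_upwards [hne] with x hx
  have hx' : 0 < |x| := abs_pos.2 hx
  rw [integral_mul_const, Complex.integral_cpow_mul_exp_neg_mul_Ioi ha0 (by positivity)]
  have : (1 / ((x ^ 2 / 2 : ℝ) : ℂ)) ^ a = 2 ^ a * ((|x| : ℝ) : ℂ) ^ (-2 * a) := by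
    have h2 : (1 / ((x ^ 2 / 2 : ℝ) : ℂ)) = ((2 : ℝ) : ℂ) * (((|x| ^ (-2 : ℝ)) : ℝ) : ℂ) := by
      rw [Real.rpow_neg hx'.le, Real.rpow_two, sq_abs]
      push_cast
      rw [one_div_div]
      rfl
    rw [h2, Complex.mul_cpow_ofReal_nonneg (by norm_num) (by positivity),
      Complex.ofReal_cpow hx'.le, Complex.cpow_mul]
    · norm_num
    all_goals
      simp [← Complex.ofReal_log hx'.le, Real.pi_pos, Real.pi_pos.le]
  rw [this]
  ring

/-- The Fourier transform of a Gaussian, moved onto an integrable function. -/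
theorem integral_gaussian_mul_fourier {φ : ℝ → ℂ} (hφ : Integrable φ) {s : ℝ} (hs : 0 < s) :
    ∫ x : ℝ, cexp (-((x ^ 2 / 2 : ℝ) * s)) *
        ((((√(2 * π))⁻¹ : ℝ) : ℂ) * ∫ t : ℝ, cexp (-(I * t * x)) * φ t) =
      (s : ℂ) ^ (-1 / 2 : ℂ) * ∫ t : ℝ, cexp (-((t ^ 2 / 2 : ℝ) * (s⁻¹ : ℝ))) * φ t := by
  have hg : Integrable fun x : ℝ ↦ cexp (-((x ^ 2 / 2 : ℝ) * s)) := by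
    refine (integrable_exp_neg_mul_sq (half_pos hs)).ofReal.congr (.of_forall fun x ↦ ?_)
    rw [RCLike.ofReal_eq_complex_ofReal]
    push_cast
    congr 1
    ring
  have hint : Integrable (Function.uncurry fun (x t : ℝ) ↦
      cexp (-(I * t * x)) * (cexp (-((x ^ 2 / 2 : ℝ) * s)) * φ t)) (volume.prod volume) := by
    refine (hg.mul_prod hφ).bdd_mul (c := 1) ?_ (.of_forall fun z ↦ ?_)
    · refine Continuous.aestronglyMeasurable ?_
      fun_prop
    · simp [Complex.norm_exp]
  have key := integral_integral_swap hint
  have e1 (x : ℝ) : cexp (-((x ^ 2 / 2 : ℝ) * s)) *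
      ((((√(2 * π))⁻¹ : ℝ) : ℂ) * ∫ t : ℝ, cexp (-(I * t * x)) * φ t) =
      (((√(2 * π))⁻¹ : ℝ) : ℂ) *
        ∫ t : ℝ, cexp (-(I * t * x)) * (cexp (-((x ^ 2 / 2 : ℝ) * s)) * φ t) := by
    simp only [mul_left_comm (cexp (-(I * _ * x))), integral_const_mul]
    ring
  simp only [e1]
  rw [integral_const_mul, key, ← integral_const_mul, ← integral_const_mul]
  congr 1
  ext t
  have e2 : ∫ x : ℝ, cexp (-(I * t * x)) * (cexp (-((x ^ 2 / 2 : ℝ) * s)) * φ t) =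
      (∫ x : ℝ, cexp (I * (-t) * x) * cexp (-(s / 2 : ℂ) * x ^ 2)) * φ t := by
    rw [← integral_mul_const]
    congr 1
    ext x
    rw [← mul_assoc]
    push_cast
    congr 3 <;> ring
  rw [e2, fourierIntegral_gaussian (by simpa using hs)]
  have e3 : ((π : ℂ) / (s / 2)) ^ (1 / 2 : ℂ) = (√(2 * π) : ℝ) * (s : ℂ) ^ (-1 / 2 : ℂ) := by
    have : ((π : ℂ) / (s / 2)) = ((2 * π * s⁻¹ : ℝ) : ℂ) := by
      push_cast
      field_simp
    rw [this, Complex.ofReal_mul, Complex.mul_cpow_ofReal_nonneg (by positivity) (by positivity),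
      Real.sqrt_eq_rpow, Complex.ofReal_cpow (by positivity), neg_div, Complex.cpow_neg,
      Complex.ofReal_inv,
      Complex.inv_cpow _ _ (by simp [Complex.arg_ofReal_of_nonneg hs.le, Real.pi_ne_zero.symm])]
    norm_num
  have e4 : -(-(t : ℂ)) ^ 2 / (4 * (s / 2)) = -((t ^ 2 / 2 : ℝ) * (s⁻¹ : ℝ)) := by
    push_cast
    have : (s : ℂ) ≠ 0 := by exact_mod_cast hs.ne'
    field_simp
    ring
  have e5 : (((√(2 * π))⁻¹ : ℝ) : ℂ) * (√(2 * π) : ℝ) = 1 := by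
    rw [← Complex.ofReal_mul, inv_mul_cancel₀ (by positivity), Complex.ofReal_one]
  rw [e3, e4]
  linear_combination ((s : ℂ) ^ (-1 / 2 : ℂ) * cexp (-((t ^ 2 / 2 : ℝ) * (s⁻¹ : ℝ))) * φ t) * e5

/-- The unitary, angular frequency Fourier transform as a rescaling of `𝓕`. -/
theorem integral_exp_neg_mul_eq_fourier (φ : ℝ → ℂ) (x : ℝ) :
    ∫ t : ℝ, cexp (-(I * t * x)) * φ t = FourierTransform.fourier φ (x / (2 * π)) := by
  rw [Real.fourier_real_eq_integral_exp_smul]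
  congr 1
  ext t
  rw [smul_eq_mul]
  congr 2
  push_cast
  have : (π : ℂ) ≠ 0 := by exact_mod_cast Real.pi_ne_zero
  field_simp

/-- For `β : ℂ` with `-1 < Re β < 0`, the tempered distribution
`T x = |x|^β` on `ℝ` has Fourier transform `F T y = C_β / |y|^(β+1)` with
`C_β = 2^(β+1/2) Γ((β+1)/2) / Γ(-β/2)`, using `F g y = (2π)^(-1/2) ∫ e^(-ixy) g x dx`.
The identity is expressed by testing against an arbitrary Schwartz function:
`⟨F T, φ⟩ = ⟨T, F φ⟩`. -/
theorem stmt1 (β : ℂ) (hβ1 : -1 < β.re) (hβ2 : β.re < 0)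
    (C : ℂ) (hC : C = 2 ^ (β + 1/2) * Complex.Gamma ((β + 1)/2) / Complex.Gamma (-β/2)) :
    ∀ φ : SchwartzMap ℝ ℂ,
      ∫ y : ℝ, (C / ((|y| : ℝ) : ℂ) ^ (β + 1)) * φ y
        = ∫ x : ℝ, ((|x| : ℝ) : ℂ) ^ β *
            ((((Real.sqrt (2 * π))⁻¹ : ℝ) : ℂ) *
              ∫ t : ℝ, Complex.exp (-(Complex.I * (t : ℂ) * (x : ℂ))) * φ t) := by
  intro φ
  obtain ⟨M, hM⟩ : ∃ M, ∀ x, ‖φ x‖ ≤ M :=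
    ⟨_, fun x ↦ φ.toBoundedContinuousFunction.norm_coe_le_norm x⟩
  set ψ : ℝ → ℂ := fun x ↦
    (((√(2 * π))⁻¹ : ℝ) : ℂ) * ∫ t : ℝ, cexp (-(I * t * x)) * φ t with hψ
  have hψ' : ψ = fun x ↦ (((√(2 * π))⁻¹ : ℝ) : ℂ) * FourierTransform.fourier φ (x / (2 * π)) := by
    ext x
    rw [hψ, SchwartzMap.fourier_coe, ← integral_exp_neg_mul_eq_fourier]
  have hψi : Integrable ψ := by
    rw [hψ']
    exact ((FourierTransform.fourier φ).integrable.comp_div (by positivity)).const_mul _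
  obtain ⟨N, hN⟩ : ∃ N, ∀ x, ‖ψ x‖ ≤ N := by
    refine ⟨‖(((√(2 * π))⁻¹ : ℝ) : ℂ)‖ *
      ‖(FourierTransform.fourier φ).toBoundedContinuousFunction‖, fun x ↦ ?_⟩
    rw [hψ', norm_mul]
    gcongr
    exact (FourierTransform.fourier φ).toBoundedContinuousFunction.norm_coe_le_norm _
  have hre1 : (-β / 2).re = -β.re / 2 := by simp
  have hre2 : ((β + 1) / 2).re = (β.re + 1) / 2 := by simp
  have h1 := mellin_integral_gaussian_mul (a := -β / 2) (by rw [hre1]; linarith)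
    (by rw [hre1]; linarith) hψi hN
  have h2 := mellin_integral_gaussian_mul (a := (β + 1) / 2) (by rw [hre2]; linarith)
    (by rw [hre2]; linarith) φ.integrable hM
  set H : ℝ → ℂ := fun s ↦ ∫ x : ℝ, cexp (-((x ^ 2 / 2 : ℝ) * s)) * φ x with hH
  have h3 : mellin (fun s ↦ ∫ x : ℝ, cexp (-((x ^ 2 / 2 : ℝ) * s)) * ψ x) (-β / 2) =
      mellin H ((β + 1) / 2) := by
    have h := mellin_cpow_smul (fun s ↦ H s⁻¹) (-β / 2) (-1 / 2)
    rw [mellin_comp_inv, show -(-β / 2 + -1 / 2) = (β + 1) / 2 by ring] at h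
    rw [← h]
    refine setIntegral_congr_fun measurableSet_Ioi fun s hs ↦ ?_
    simp only [hψ, hH, integral_gaussian_mul_fourier φ.integrable hs, smul_eq_mul]
  rw [h1, h2, show -2 * (-β / 2) = β by ring, show -2 * ((β + 1) / 2) = -(β + 1) by ring] at h3
  have hΓ : Complex.Gamma (-β / 2) ≠ 0 :=
    Complex.Gamma_ne_zero_of_re_pos (by rw [hre1]; linarith)
  have h2ne : (2 : ℂ) ^ (-β / 2) ≠ 0 := by simp
  have hpow : (2 : ℂ) ^ (β + 1 / 2) * 2 ^ (-β / 2) = 2 ^ ((β + 1) / 2) := by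
    rw [← Complex.cpow_add _ _ two_ne_zero]
    congr 1
    ring
  simp only [div_eq_mul_inv C, ← Complex.cpow_neg, mul_assoc C, integral_const_mul]
  refine mul_left_cancel₀ (mul_ne_zero h2ne hΓ) ?_
  rw [h3, hC, ← hpow]
  generalize Complex.Gamma (-β / 2) = G at hΓ
  field_simp
end

section
/- Let X be a standard symmetric α-stable random variable with 0<α≤2, and β ∈ ℂ with -1 < Re(β) < 0. Then E|X|^β = 2^β Γ((β+1)/2) Γ(1 - β/α) / (√π Γ(1 - β/2)). -/
open MeasureTheory ProbabilityTheory

/-- Mellin transform of `t ↦ exp (-c t ^ p)`. -/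
theorem integral_cpow_mul_exp_neg_mul_rpow {p c : ℝ} (hp : 0 < p) (hc : 0 < c) {s : ℂ}
    (hs : 0 < s.re) :
    ∫ t in Set.Ioi (0 : ℝ), (t : ℂ) ^ (s - 1) * (Real.exp (-(c * t ^ p)) : ℂ)
      = (p : ℂ)⁻¹ * (c : ℂ) ^ (-(s / p)) * Complex.Gamma (s / p) := by
  have hsp : 0 < (s / p).re := by
    rw [Complex.div_ofReal_re]; positivity
  have h := mellin_comp_rpow (fun t : ℝ => (Real.exp (-(c * t)) : ℂ)) s p
  have h2 := mellin_comp_mul_left (fun t : ℝ => (Real.exp (-t) : ℂ)) (s / p) hc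
  rw [h2] at h
  rw [← Complex.GammaIntegral_eq_mellin, ← Complex.Gamma_eq_integral hsp, abs_of_pos hp] at h
  simp only [mellin, smul_eq_mul, Complex.real_smul, Complex.ofReal_inv] at h
  rw [h, mul_assoc]

theorem integrableOn_rpow_mul_exp_neg_const_mul_rpow {p q c : ℝ} (hp : 0 < p) (hq : -1 < q)
    (hc : 0 < c) :
    IntegrableOn (fun t : ℝ => t ^ q * Real.exp (-(c * t ^ p))) (Set.Ioi 0) := by
  apply Integrable.of_integral_ne_zero
  have h := integral_rpow_mul_exp_neg_mul_rpow hp hq hc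
  simp only [neg_mul] at h
  rw [h]
  have : 0 < (q + 1) / p := div_pos (by linarith) hp
  have := Real.Gamma_pos_of_pos this
  positivity

theorem norm_cpow_mul_exp {t : ℝ} (ht : 0 < t) (s : ℂ) (r : ℝ) :
    ‖(t : ℂ) ^ s * (Real.exp r : ℂ)‖ = t ^ s.re * Real.exp r := by
  rw [norm_mul, Complex.norm_cpow_eq_rpow_re_of_pos ht, Complex.norm_real,
    Real.norm_of_nonneg (Real.exp_pos _).le]

theorem integrable_abs_cpow_mul_exp_neg_sq {s : ℂ} (hs : -1 < s.re) :
    Integrable (fun x : ℝ => ((|x| : ℝ) : ℂ) ^ s * (Real.exp (-(1 / 2 * x ^ 2)) : ℂ)) := by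
  have hreal : Integrable (fun x : ℝ => |x| ^ s.re * Real.exp (-(1 / 2 * |x| ^ (2 : ℝ)))) := by
    apply Integrable.of_integral_ne_zero
    rw [integral_comp_abs (f := fun x : ℝ => x ^ s.re * Real.exp (-(1 / 2 * x ^ (2 : ℝ))))]
    have h := integral_rpow_mul_exp_neg_mul_rpow (p := 2) (b := 1 / 2) (by norm_num) hs
      (by norm_num)
    simp only [neg_mul] at h
    rw [h]
    have : 0 < (s.re + 1) / 2 := by linarith
    have := Real.Gamma_pos_of_pos this
    positivity
  refine hreal.mono' (by fun_prop) ?_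
  have h0 : ∀ᵐ x : ℝ, x ≠ 0 := by simp [ae_iff]
  filter_upwards [h0] with x hx
  rw [norm_cpow_mul_exp (abs_pos.2 hx)]
  simp

theorem integral_abs_cpow_mul_exp_neg_sq {s : ℂ} (hs : -1 < s.re) :
    ∫ x : ℝ, ((|x| : ℝ) : ℂ) ^ s * (Real.exp (-(1 / 2 * x ^ 2)) : ℂ)
      = 2 ^ ((s + 1) / 2) * Complex.Gamma ((s + 1) / 2) := by
  have hI := integrable_abs_cpow_mul_exp_neg_sq hs
  rw [← intervalIntegral.integral_Iic_add_Ioi (b := 0) hI.integrableOn hI.integrableOn]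
  have hneg := integral_comp_neg_Ioi (0 : ℝ)
    (fun x : ℝ => ((|x| : ℝ) : ℂ) ^ s * (Real.exp (-(1 / 2 * x ^ 2)) : ℂ))
  simp only [abs_neg, even_two.neg_pow, neg_zero] at hneg
  rw [← hneg]
  have h := integral_cpow_mul_exp_neg_mul_rpow (p := 2) (c := 1 / 2) (s := s + 1) (by norm_num)
    (by norm_num) (by simp; linarith)
  have hcongr : ∫ x in Set.Ioi (0 : ℝ), ((|x| : ℝ) : ℂ) ^ s * (Real.exp (-(1 / 2 * x ^ 2)) : ℂ)
      = ∫ t in Set.Ioi (0 : ℝ),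
        (t : ℂ) ^ (s + 1 - 1) * (Real.exp (-(1 / 2 * t ^ (2 : ℝ))) : ℂ) := by
    refine setIntegral_congr_fun measurableSet_Ioi fun x hx => ?_
    simp only [abs_of_pos (Set.mem_Ioi.1 hx), add_sub_cancel_right, Real.rpow_two]
  rw [hcongr, h]
  have h2 : (((1 / 2 : ℝ) : ℝ) : ℂ) ^ (-((s + 1) / (2 : ℝ))) = 2 ^ ((s + 1) / 2) := by
    rw [one_div, Complex.ofReal_inv, Complex.inv_cpow _ _ ?_, Complex.cpow_neg, inv_inv]
    · push_cast; rfl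
    · rw [Complex.arg_ofReal_of_nonneg (by norm_num)]; exact Real.pi_pos.ne
  rw [h2]
  push_cast
  ring

theorem integrable_abs_cpow_gaussianReal {s : ℂ} (hs : -1 < s.re) :
    Integrable (fun x : ℝ => ((|x| : ℝ) : ℂ) ^ s) (gaussianReal 0 1) := by
  rw [gaussianReal_of_var_ne_zero _ one_ne_zero,
    integrable_withDensity_iff_integrable_smul' (measurable_gaussianPDF _ _)
      (ae_of_all _ fun _ ↦ gaussianPDF_lt_top)]
  refine ((integrable_abs_cpow_mul_exp_neg_sq hs).const_mul
    (((√(2 * Real.pi))⁻¹ : ℝ) : ℂ)).congr (ae_of_all _ fun x => ?_)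
  simp only [toReal_gaussianPDF, gaussianPDFReal_def, Complex.real_smul]
  rw [show -(x - 0) ^ 2 / (2 * ((1 : NNReal) : ℝ)) = -(1 / 2 * x ^ 2) by simp; ring]
  push_cast
  simp
  ring

/-- Absolute moments of the standard Gaussian distribution, of complex order. -/
theorem integral_abs_cpow_gaussianReal {s : ℂ} (hs : -1 < s.re) :
    ∫ x : ℝ, ((|x| : ℝ) : ℂ) ^ s ∂(gaussianReal 0 1)
      = 2 ^ (s / 2) * Complex.Gamma ((s + 1) / 2) / ((√Real.pi : ℝ) : ℂ) := by
  rw [integral_gaussianReal_eq_integral_smul one_ne_zero]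
  have h : ∀ x : ℝ, gaussianPDFReal 0 1 x • ((|x| : ℝ) : ℂ) ^ s = (((√(2 * Real.pi))⁻¹ : ℝ) : ℂ) *
      (((|x| : ℝ) : ℂ) ^ s * (Real.exp (-(1 / 2 * x ^ 2)) : ℂ)) := by
    intro x
    simp only [gaussianPDFReal_def, Complex.real_smul]
    rw [show -(x - 0) ^ 2 / (2 * ((1 : NNReal) : ℝ)) = -(1 / 2 * x ^ 2) by simp; ring]
    push_cast
    simp
    ring
  simp_rw [h]
  rw [integral_const_mul, integral_abs_cpow_mul_exp_neg_sq hs,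
    Real.sqrt_mul (by norm_num : (0 : ℝ) ≤ 2), add_div, Complex.cpow_add _ _ two_ne_zero]
  have h2 : ((√2 : ℝ) : ℂ) = (2 : ℂ) ^ ((1 : ℂ) / 2) := by
    rw [Real.sqrt_eq_rpow, Complex.ofReal_cpow (by norm_num)]
    push_cast; rfl
  have h3 : (2 : ℂ) ^ ((1 : ℂ) / 2) ≠ 0 := by simp [Complex.cpow_eq_zero_iff]
  have h4 : ((√Real.pi : ℝ) : ℂ) ≠ 0 := by
    exact_mod_cast (Real.sqrt_pos.2 Real.pi_pos).ne'
  push_cast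
  rw [h2]
  field_simp

/-- The Laplace transform of `X² / 2` is a Gaussian mixture of the characteristic function. -/
theorem integral_exp_neg_sq_mul_of_charFun {Ω : Type*} [MeasurableSpace Ω] {μ : Measure Ω}
    [IsProbabilityMeasure μ] {X : Ω → ℝ} (hX : Measurable X) {φ : ℝ → ℂ}
    (hchar : ∀ θ : ℝ, ∫ ω, Complex.exp (Complex.I * (θ : ℂ) * (X ω : ℂ)) ∂μ = φ θ)
    {t : ℝ} (ht : 0 ≤ t) :
    ∫ ω, (Real.exp (-(X ω ^ 2 / 2 * t)) : ℂ) ∂μ = ∫ g, φ (√t * g) ∂(gaussianReal 0 1) := by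
  have hg : ∀ ω, (Real.exp (-(X ω ^ 2 / 2 * t)) : ℂ)
      = ∫ g, Complex.exp (Complex.I * ((√t * g : ℝ) : ℂ) * (X ω : ℂ)) ∂(gaussianReal 0 1) := by
    intro ω
    have h := charFun_gaussianReal (μ := 0) (v := 1) (√t * X ω)
    rw [charFun_apply_real] at h
    have ht2 : ((√t : ℝ) : ℂ) ^ 2 = t := by
      rw [← Complex.ofReal_pow, Real.sq_sqrt ht]
    calc (Real.exp (-(X ω ^ 2 / 2 * t)) : ℂ) = _ := by
          push_cast
          rw [← ht2]
          ring_nf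
      _ = _ := h.symm
      _ = _ := by
          refine integral_congr_ae (ae_of_all _ fun g => ?_)
          simp only
          congr 1
          push_cast
          ring
  simp_rw [hg]
  rw [integral_integral_swap]
  · simp_rw [hchar]
  · refine Integrable.of_bound (C := 1) (by fun_prop) (ae_of_all _ fun x => ?_)
    simp only [Function.uncurry]
    rw [mul_assoc, mul_comm, ← Complex.ofReal_mul, Complex.norm_exp_ofReal_mul_I]

theorem gaussianReal_ae_ne_zero : ∀ᵐ g ∂(gaussianReal 0 1), g ≠ 0 :=
  (gaussianReal_absolutelyContinuous 0 one_ne_zero).ae_le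
    (show ∀ᵐ x : ℝ, x ≠ 0 by simp [ae_iff])

/-- `E[|g|^(-s)]` for a Gaussian `g` as a double integral: absolute convergence. -/
theorem integrable_cpow_mul_exp_neg_gaussianReal_prod {α : ℝ} (hα : 0 < α) {s : ℂ}
    (hs0 : 0 < s.re) (hs1 : s.re < 1) :
    Integrable (fun p : ℝ × ℝ => (p.2 : ℂ) ^ (s / 2 - 1) *
        (Real.exp (-(|p.1| ^ α * p.2 ^ (α / 2))) : ℂ))
      ((gaussianReal 0 1).prod (volume.restrict (Set.Ioi 0))) := by
  have hre : (s / 2 - 1).re = s.re / 2 - 1 := by simp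
  rw [integrable_prod_iff (by fun_prop)]
  constructor
  · filter_upwards [gaussianReal_ae_ne_zero] with g hg
    refine (integrableOn_rpow_mul_exp_neg_const_mul_rpow (half_pos hα)
      (by linarith : -1 < s.re / 2 - 1)
      (Real.rpow_pos_of_pos (abs_pos.2 hg) α)).mono' (by fun_prop) ?_
    filter_upwards [ae_restrict_mem measurableSet_Ioi] with t ht
    rw [norm_cpow_mul_exp ht, hre]
  · have hI := (integrable_abs_cpow_gaussianReal (s := -s) (by simpa using hs1)).norm.mul_const
      (1 / (α / 2) * Real.Gamma (s.re / 2 / (α / 2)))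
    refine hI.congr ?_
    filter_upwards [gaussianReal_ae_ne_zero] with g hg
    have hg' := abs_pos.2 hg
    have h := integral_rpow_mul_exp_neg_mul_rpow (half_pos hα)
      (by linarith : -1 < s.re / 2 - 1) (Real.rpow_pos_of_pos hg' α)
    rw [Complex.norm_cpow_eq_rpow_re_of_pos hg', Complex.neg_re]
    rw [setIntegral_congr_fun (g := fun t : ℝ => t ^ (s.re / 2 - 1) *
      Real.exp (-(|g| ^ α) * t ^ (α / 2))) measurableSet_Ioi, h, sub_add_cancel, ← Real.rpow_mul
      hg'.le, mul_assoc]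
    · congr 2
      field_simp
    · intro t ht
      simp only
      rw [norm_cpow_mul_exp ht, hre, neg_mul]

/-- If `X` is a standard symmetric `α`-stable random variable
(`0 < α ≤ 2`, characteristic function `exp (-|θ|^α)`) and `β : ℂ` with `-1 < Re β < 0`,
then `E|X|^β = 2^β Γ((β+1)/2) Γ(1-β/α) / (√π Γ(1-β/2))`. -/
theorem stmt3 {Ω : Type*} [MeasureSpace Ω] [IsProbabilityMeasure (ℙ : Measure Ω)]
    (α : ℝ) (hα : 0 < α) (hα2 : α ≤ 2) (X : Ω → ℝ) (hX : Measurable X)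
    (hchar : ∀ θ : ℝ, ∫ ω, Complex.exp (Complex.I * (θ : ℂ) * (X ω : ℂ))
      = Complex.exp (-((|θ| ^ α : ℝ) : ℂ)))
    (β : ℂ) (h1 : -1 < β.re) (h2 : β.re < 0) :
    ∫ ω, ((|X ω| : ℝ) : ℂ) ^ β
      = 2 ^ β * Complex.Gamma ((β + 1) / 2) * Complex.Gamma (1 - β / (α : ℂ)) /
        (((Real.sqrt Real.pi : ℝ) : ℂ) * Complex.Gamma (1 - β / 2)) := by
  obtain ⟨s, rfl⟩ : ∃ s, β = -s := ⟨-β, (neg_neg β).symm⟩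
  simp only [Complex.neg_re, neg_lt_neg_iff, Left.neg_neg_iff] at h1 h2
  have hre : (s / 2 - 1).re = s.re / 2 - 1 := by simp
  have hs2 : 0 < (s / 2).re := by simpa using h2
  have hsα : 0 < (s / α).re := by rw [Complex.div_ofReal_re]; positivity
  have hαC : (α : ℂ) ≠ 0 := by exact_mod_cast hα.ne'
  have hs0 : s ≠ 0 := by rintro rfl; simp at h2
  -- the Laplace transform of `X ^ 2 / 2`
  have hLap : ∀ t : ℝ, 0 ≤ t → ∫ ω, (Real.exp (-(X ω ^ 2 / 2 * t)) : ℂ)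
      = ∫ g, (Real.exp (-(|g| ^ α * t ^ (α / 2))) : ℂ) ∂(gaussianReal 0 1) := by
    intro t ht
    rw [integral_exp_neg_sq_mul_of_charFun hX hchar ht]
    refine integral_congr_ae (ae_of_all _ fun g => ?_)
    simp only
    rw [abs_mul, abs_of_nonneg (Real.sqrt_nonneg t), Real.mul_rpow (Real.sqrt_nonneg t)
      (abs_nonneg g), Real.sqrt_eq_rpow, ← Real.rpow_mul ht, one_div_mul_eq_div, mul_comm]
    push_cast
    rfl
  have hB := integrable_cpow_mul_exp_neg_gaussianReal_prod hα h2 h1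
  have hA : Integrable (fun p : Ω × ℝ => (p.2 : ℂ) ^ (s / 2 - 1) *
        (Real.exp (-(X p.1 ^ 2 / 2 * p.2)) : ℂ))
      ((ℙ : Measure Ω).prod (volume.restrict (Set.Ioi 0))) := by
    rw [integrable_prod_iff' (by fun_prop)]
    constructor
    · filter_upwards [ae_restrict_mem measurableSet_Ioi] with t ht
      refine Integrable.of_bound (C := t ^ (s / 2 - 1).re) (by fun_prop) (ae_of_all _ fun ω => ?_)
      rw [norm_cpow_mul_exp ht]
      have ht' : 0 < t := ht
      exact mul_le_of_le_one_right (by positivity) (Real.exp_le_one_iff.2 (by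
        have : 0 ≤ X ω ^ 2 / 2 * t := by positivity
        linarith))
    · refine ((integrable_prod_iff' hB.1).1 hB).2.congr ?_
      filter_upwards [ae_restrict_mem measurableSet_Ioi] with t ht
      simp only [norm_cpow_mul_exp ht]
      rw [integral_const_mul, integral_const_mul]
      congr 1
      have h := hLap t (le_of_lt ht)
      rw [integral_complex_ofReal, integral_complex_ofReal] at h
      exact_mod_cast h.symm
  have hX0 : ∀ᵐ ω, X ω ≠ 0 := by
    filter_upwards [((integrable_prod_iff hA.1).1 hA).1] with ω hω h0
    refine not_integrableOn_Ioi_rpow (s.re / 2 - 1) (hω.norm.congr ?_)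
    filter_upwards [ae_restrict_mem measurableSet_Ioi] with t ht
    rw [norm_cpow_mul_exp ht, hre, h0]
    simp
  have hkey : ∫ ω, ∫ t in Set.Ioi (0 : ℝ), (t : ℂ) ^ (s / 2 - 1) *
        (Real.exp (-(X ω ^ 2 / 2 * t)) : ℂ)
      = ∫ g, (∫ t in Set.Ioi (0 : ℝ), (t : ℂ) ^ (s / 2 - 1) *
        (Real.exp (-(|g| ^ α * t ^ (α / 2))) : ℂ)) ∂(gaussianReal 0 1) := by
    refine (integral_integral_swap hA).trans (Eq.trans ?_ (integral_integral_swap hB).symm)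
    refine setIntegral_congr_fun measurableSet_Ioi fun t ht => ?_
    rw [integral_const_mul, integral_const_mul, hLap t (le_of_lt ht)]
  have hleft : ∫ ω, ∫ t in Set.Ioi (0 : ℝ), (t : ℂ) ^ (s / 2 - 1) *
        (Real.exp (-(X ω ^ 2 / 2 * t)) : ℂ)
      = (∫ ω, ((|X ω| : ℝ) : ℂ) ^ (-s)) * (2 ^ (s / 2) * Complex.Gamma (s / 2)) := by
    rw [← integral_mul_const]
    refine integral_congr_ae ?_
    filter_upwards [hX0] with ω hω
    have h := integral_cpow_mul_exp_neg_mul_rpow one_pos (c := X ω ^ 2 / 2) (by positivity) hs2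
    simp only [Real.rpow_one] at h
    have hX2 : X ω ^ 2 / 2 = |X ω| * |X ω| * 2⁻¹ := by rw [abs_mul_abs_self]; ring
    rw [h, hX2, Complex.ofReal_mul, Complex.mul_cpow_ofReal_nonneg (by positivity) (by positivity),
      Complex.ofReal_mul, Complex.mul_cpow_ofReal_nonneg (abs_nonneg _) (abs_nonneg _),
      ← Complex.cpow_add _ _ (by simpa using hω), Complex.ofReal_inv,
      Complex.inv_cpow _ _ (by
        rw [Complex.arg_ofReal_of_nonneg (by norm_num)]; exact Real.pi_pos.ne),
      Complex.cpow_neg ((2 : ℝ) : ℂ), inv_inv]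
    simp only [Complex.ofReal_one, inv_one, div_one, one_mul, ← neg_add, add_halves,
      Complex.ofReal_ofNat, mul_assoc]
  have hright : ∫ g, (∫ t in Set.Ioi (0 : ℝ), (t : ℂ) ^ (s / 2 - 1) *
        (Real.exp (-(|g| ^ α * t ^ (α / 2))) : ℂ)) ∂(gaussianReal 0 1)
      = (∫ g, ((|g| : ℝ) : ℂ) ^ (-s) ∂(gaussianReal 0 1)) *
        (2 / α * Complex.Gamma (s / α)) := by
    rw [← integral_mul_const]
    refine integral_congr_ae ?_
    filter_upwards [gaussianReal_ae_ne_zero] with g hg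
    have hg' := abs_pos.2 hg
    have hdiv : s / 2 / ((α / 2 : ℝ) : ℂ) = s / α := by push_cast; field_simp
    rw [integral_cpow_mul_exp_neg_mul_rpow (half_pos hα) (Real.rpow_pos_of_pos hg' α) hs2, hdiv,
      ← Complex.cpow_mul_ofReal_nonneg hg'.le, mul_neg, mul_div_cancel₀ _ hαC]
    push_cast
    rw [inv_div]
    ring
  rw [hleft, hright, integral_abs_cpow_gaussianReal (by simpa using h1)] at hkey
  have hΓ : Complex.Gamma (s / 2) ≠ 0 := Complex.Gamma_ne_zero_of_re_pos hs2
  have h2s : (2 : ℂ) ^ (s / 2) ≠ 0 := by simp [Complex.cpow_eq_zero_iff]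
  have hpi : ((√Real.pi : ℝ) : ℂ) ≠ 0 := by
    exact_mod_cast (Real.sqrt_pos.2 Real.pi_pos).ne'
  have h2neg : (2 : ℂ) ^ (-s) = 2 ^ (-s / 2) * (2 ^ (s / 2))⁻¹ := by
    rw [← Complex.cpow_neg, ← Complex.cpow_add _ _ two_ne_zero]
    congr 1
    ring
  rw [eq_div_of_mul_eq (mul_ne_zero h2s hΓ) hkey, h2neg,
    show 1 - -s / (α : ℂ) = s / α + 1 by ring, show 1 - -s / 2 = s / 2 + 1 by ring,
    Complex.Gamma_add_one _ (div_ne_zero hs0 hαC),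
    Complex.Gamma_add_one _ (div_ne_zero hs0 two_ne_zero)]
  field_simp
end
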